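/- Let G be a group acting on a finite set W of size 2g + 2 with g even, with n orbits, all of even size. With J = ker(Σ : 𝔽₂[W] → 𝔽₂)/𝔽₂·Δ as before, one has dim_{𝔽₂} J^G = n − 1. -/

import Mathlib

/-- The sum (augmentation) map `𝔽₂[W] → 𝔽₂`. -/
def sumMap (W : Type*) [Fintype W] : (W → ZMod 2) →ₗ[ZMod 2] ZMod 2 where
  toFun f := ∑ w, f w
  map_add' f g := by simp [Finset.sum_add_distrib]
  map_smul' c f := by simp [Finset.mul_sum]

/-- The linear permutation action of `g : G` on `𝔽₂[W]`. -/
def permMap {G : Type*} [Group G] (W : Type*) [MulAction G W] (a : G) :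
    (W → ZMod 2) →ₗ[ZMod 2] (W → ZMod 2) where
  toFun f := fun w => f (a⁻¹ • w)
  map_add' _ _ := rfl
  map_smul' _ _ := rfl

open MulAction in
/-- Functions on the orbit space, pulled back to `W`. -/
def orbitPullback (G W : Type*) [Group G] [MulAction G W] :
    (orbitRel.Quotient G W → ZMod 2) →ₗ[ZMod 2] (W → ZMod 2) :=
  LinearMap.funLeft (ZMod 2) (ZMod 2) (Quotient.mk (orbitRel G W))

open MulAction in
theorem orbitPullback_injective (G W : Type*) [Group G] [MulAction G W] :
    Function.Injective (orbitPullback G W) :=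
  LinearMap.funLeft_injective_of_surjective _ _ _ Quotient.mk_surjective

open MulAction in
theorem permMap_orbitPullback {G W : Type*} [Group G] [MulAction G W]
    (a : G) (f : orbitRel.Quotient G W → ZMod 2) :
    permMap W a (orbitPullback G W f) = orbitPullback G W f := by
  funext w
  exact congrArg f (Quotient.sound (orbitRel_apply.2 ⟨a⁻¹, rfl⟩))

open MulAction in
theorem exists_orbitPullback_eq {G W : Type*} [Group G] [MulAction G W]
    {x : W → ZMod 2} (hx : ∀ a : G, permMap W a x = x) :
    ∃ f, orbitPullback G W f = x := by
  refine ⟨Quotient.lift x ?_, rfl⟩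
  rintro v w ⟨a, rfl⟩
  simpa [permMap] using (congrFun (hx a) (a • w)).symm

open MulAction in
theorem sumMap_orbitPullback {G W : Type*} [Group G] [Fintype W] [MulAction G W]
    (heo : ∀ w : W, Even (Nat.card (orbit G w))) (f : orbitRel.Quotient G W → ZMod 2) :
    sumMap W (orbitPullback G W f) = 0 := by
  classical
  have : Fintype (orbitRel.Quotient G W) := Fintype.ofFinite _
  change ∑ w, f (Quotient.mk (orbitRel G W) w) = 0
  rw [← Finset.sum_fiberwise Finset.univ (Quotient.mk (orbitRel G W))]
  refine Finset.sum_eq_zero fun q _ => ?_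
  rw [Finset.sum_congr rfl (g := fun _ => f q) (by simp +contextual)]
  induction q using Quotient.inductionOn with | h v => ?_
  have hc : Nat.card (orbit G v) =
      (Finset.univ.filter fun w => Quotient.mk (orbitRel G W) w = Quotient.mk _ v).card := by
    rw [Nat.card_eq_card_toFinset (orbit G v)]
    congr 1
    ext w
    simp only [Set.mem_toFinset, Finset.mem_filter, Finset.mem_univ, true_and, Quotient.eq]
    exact orbitRel_apply.symm
  rw [Finset.sum_const, ← hc, nsmul_eq_mul, (ZMod.natCast_eq_zero_iff_even).2 (heo v), zero_mul]

theorem permMap_ne_add_one {G W : Type*} [Group G] [Fintype W] [MulAction G W]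
    {k : ℕ} (hk : Odd k) (hcard : Fintype.card W = 2 * k)
    {x : W → ZMod 2} (hx : sumMap W x = 0) (a : G) :
    permMap W a x ≠ x + 1 := by
  intro h
  have h1 : ∀ w, (x (a⁻¹ • w)).val + (x w).val = 1 := fun w => by
    have hw : x (a⁻¹ • w) = x w + 1 := congrFun h w
    rw [hw]
    generalize x w = c
    revert c
    decide
  have h2 : ∑ w, (x (a⁻¹ • w)).val = ∑ w, (x w).val :=
    Equiv.sum_comp (MulAction.toPerm a⁻¹) fun w => (x w).val
  have h3 : ∑ w, ((x (a⁻¹ • w)).val + (x w).val) = 2 * k := by simp [h1, hcard]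
  rw [Finset.sum_add_distrib, h2] at h3
  have h4 : ∑ w, (x w).val = k := by omega
  have h5 : ((∑ w, (x w).val : ℕ) : ZMod 2) = 0 := by
    rw [Nat.cast_sum, ← hx]
    exact Finset.sum_congr rfl fun w _ => ZMod.natCast_zmod_val _
  rw [h4, ZMod.natCast_eq_zero_iff_even] at h5
  exact Nat.not_even_iff_odd.2 hk h5

/-- Let `G` act on a finite set `W` of size `2g+2` with `g` even and all orbits of even size, and let `J = ker(Σ)/𝔽₂·Δ` where `Σ : 𝔽₂[W] → 𝔽₂` is the sum map and `Δ` the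
all-ones vector.  If `G` has `n` orbits on `W`, then `dim_{𝔽₂} J^G = n - 1`.
(The side hypotheses `heven`, `hker`, `hq` — that `Δ ∈ ker Σ`, that the permutation
action preserves `ker Σ`, and that it preserves the line spanned by `Δ` — are
automatic.) -/
theorem stmt_13 {G W : Type*} [Group G] [Fintype W] [MulAction G W]
    (g : ℕ) (hg : 2 ≤ g) (hgeven : Even g) (hcard : Fintype.card W = 2 * g + 2)
    (heven : (fun _ => (1 : ZMod 2)) ∈ LinearMap.ker (sumMap W))
    (hker : ∀ a : G, ∀ x ∈ LinearMap.ker (sumMap W),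
      permMap W a x ∈ LinearMap.ker (sumMap W))
    (hq : ∀ a : G,
      Submodule.span (ZMod 2)
          {(⟨fun _ => (1 : ZMod 2), heven⟩ : LinearMap.ker (sumMap W))} ≤
        (Submodule.span (ZMod 2)
            {(⟨fun _ => (1 : ZMod 2), heven⟩ : LinearMap.ker (sumMap W))}).comap
          ((permMap W a).restrict (hker a)))
    (heo : ∀ w : W, Even (Nat.card (MulAction.orbit G w))) :
    Module.finrank (ZMod 2)
        ↥(⨅ a : G, LinearMap.eqLocus
            (Submodule.mapQ _ _ ((permMap W a).restrict (hker a)) (hq a)) LinearMap.id) =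
      Nat.card (MulAction.orbitRel.Quotient G W) - 1 := by
  set Δ : LinearMap.ker (sumMap W) := ⟨fun _ => (1 : ZMod 2), heven⟩
  have : Fintype (MulAction.orbitRel.Quotient G W) := Fintype.ofFinite _
  have hW : Nonempty W := Fintype.card_pos_iff.1 (by omega)
  have hQ : Nonempty (MulAction.orbitRel.Quotient G W) := hW.map (Quotient.mk _)
  let P := (orbitPullback G W).codRestrict (LinearMap.ker (sumMap W))
    (sumMap_orbitPullback heo)
  let Φ := (Submodule.span (ZMod 2) {Δ}).mkQ ∘ₗ P
  have hker1 : LinearMap.ker Φ = Submodule.span (ZMod 2) {1} := by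
    have hP1 : P 1 = Δ := rfl
    have hPinj : LinearMap.ker P = ⊥ := LinearMap.ker_eq_bot.2 fun f f' h =>
      orbitPullback_injective G W (congrArg Subtype.val h)
    rw [LinearMap.ker_comp, Submodule.ker_mkQ, ← hP1, ← Set.image_singleton,
      ← Submodule.map_span, Submodule.comap_map_eq, hPinj, sup_bot_eq]
  have hrange : LinearMap.range Φ = ⨅ a : G, LinearMap.eqLocus
      (Submodule.mapQ _ _ ((permMap W a).restrict (hker a)) (hq a)) LinearMap.id := by
    apply le_antisymm
    · rintro _ ⟨f, rfl⟩
      simp only [Submodule.mem_iInf, LinearMap.mem_eqLocus]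
      intro a
      exact congrArg (Submodule.mkQ _) (Subtype.ext (permMap_orbitPullback a f))
    · intro y hy
      obtain ⟨x, rfl⟩ := Submodule.mkQ_surjective _ y
      simp only [Submodule.mem_iInf, LinearMap.mem_eqLocus] at hy
      have hinv : ∀ a : G, permMap W a x.1 = x.1 := fun a => by
        have h := (Submodule.Quotient.eq _).1 (hy a)
        obtain ⟨c, hc⟩ := Submodule.mem_span_singleton.1 h
        have hc' : c • (1 : W → ZMod 2) = permMap W a x.1 - x.1 := congrArg Subtype.val hc
        obtain rfl | rfl : c = 0 ∨ c = 1 := by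
          exact (by decide : ∀ d : ZMod 2, d = 0 ∨ d = 1) c
        · rw [zero_smul] at hc'
          exact sub_eq_zero.1 hc'.symm
        · rw [one_smul] at hc'
          exact absurd (sub_eq_iff_eq_add'.1 hc'.symm)
            (permMap_ne_add_one hgeven.add_one (by omega) x.2 a)
      obtain ⟨f, hf⟩ := exists_orbitPullback_eq hinv
      exact ⟨f, congrArg (Submodule.mkQ _) (Subtype.ext hf)⟩
  have hrn := Φ.finrank_range_add_finrank_ker
  rw [hker1, finrank_span_singleton one_ne_zero, Module.finrank_pi, hrange] at hrn
  rw [Nat.card_eq_fintype_card, ← hrn, Nat.add_sub_cancel]
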